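/- Under the assumptions of the positivity principle (Ω ⊂ ℝ^n bounded open with smooth boundary; A elliptic with a_{ij}, a_j ∈ C(Ω̄); k ∈ L¹(0,T) ∩ C(0,T] positive, decreasing, k(t) → ∞ as t → 0⁺; f ∈ C(ℝ×[0,T]×Ω̄) with f(w,t,x) ≥ −M|w| for w ∈ (−η,0); u ∈ C([0,T]×Ω̄) with u_{x_j}, u_{x_i x_j} ∈ C((0,T]×Ω̄) and D^{{k}}[u − u_0] ∈ C((0,T]×Ω̄) solving D^{{k}}[u − u_0] = Au + f(u,·,·) on (0,T)×Ω, u(0,·) = u_0 ≥ 0, u = g ≥ 0 on (0,T)×∂Ω, and condition (as4)): if f(0,t_0,x_0) > 0 for some (t_0,x_0) ∈ (0,T]×Ω, then u(t_0,x_0) > 0. -/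

import Mathlib

open Set MeasureTheory Filter Topology

/-- The convolution `t ↦ ∫_0^t k(t-τ) w(τ) dτ`. -/
noncomputable def kConv (k w : ℝ → ℝ) (t : ℝ) : ℝ := ∫ τ in (0:ℝ)..t, k (t - τ) * w τ

/-- The generalized fractional derivative `D^{{k}} w = (d/dt) ∫_0^t k(t-τ) w(τ) dτ`
(derivative within `[0,T]`, i.e. one-sided at the endpoints). -/
noncomputable def Dk (k : ℝ → ℝ) (T : ℝ) (w : ℝ → ℝ) (t : ℝ) : ℝ :=
  derivWithin (kConv k w) (Icc 0 T) t

/-- The kernel assumptions: `k ∈ L¹(0,T) ∩ C(0,T]`, `k > 0`, `k` decreasing. -/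
def KernelOK (k : ℝ → ℝ) (T : ℝ) : Prop :=
  IntegrableOn k (Ioc 0 T) ∧ ContinuousOn k (Ioc 0 T) ∧ (∀ t ∈ Ioc 0 T, 0 < k t) ∧
    ∀ s ∈ Ioc (0:ℝ) T, ∀ t ∈ Ioc (0:ℝ) T, s ≤ t → k t ≤ k s

/-- Partial derivative `∂v/∂x_i`. -/
noncomputable def pd {n : ℕ} (i : Fin n) (v : (Fin n → ℝ) → ℝ) (x : Fin n → ℝ) : ℝ :=
  fderiv ℝ v x (Pi.single i 1)

/-- The second order operator
`A(x)v = Σ_{i,j} a_{ij}(x) ∂²v/∂x_i∂x_j + Σ_j a_j(x) ∂v/∂x_j`. -/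
noncomputable def ellOp {n : ℕ} (aC : Fin n → Fin n → (Fin n → ℝ) → ℝ)
    (bC : Fin n → (Fin n → ℝ) → ℝ) (v : (Fin n → ℝ) → ℝ) (x : Fin n → ℝ) : ℝ :=
  (∑ i, ∑ j, aC i j x * pd i (pd j v) x) + ∑ j, bC j x * pd j v x

/-- Uniform ellipticity: `Σ_{i,j} a_{ij}(x) ξ_i ξ_j ≥ c |ξ|²` on `Ω`. -/
def IsElliptic {n : ℕ} (aC : Fin n → Fin n → (Fin n → ℝ) → ℝ) (Ω : Set (Fin n → ℝ)) : Prop :=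
  ∃ c > 0, ∀ x ∈ Ω, ∀ ξ : Fin n → ℝ, c * ∑ i, ξ i ^ 2 ≤ ∑ i, ∑ j, aC i j x * ξ i * ξ j

/-- Condition (as4): for every `t ∈ (0,T]`, `x ∈ Ω̄`,
`(1/ε) ∫_0^ε k(τ)dτ · sup_{0≤s≤ε} |u(t-s,x) - u(t,x)| → 0` as `ε → 0⁺`. -/
def As4 {n : ℕ} (k : ℝ → ℝ) (T : ℝ) (Ω : Set (Fin n → ℝ)) (u : ℝ → (Fin n → ℝ) → ℝ) : Prop :=
  ∀ t ∈ Ioc (0:ℝ) T, ∀ x ∈ closure Ω,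
    Tendsto (fun ε => ε⁻¹ * (∫ τ in (0:ℝ)..ε, k τ) *
        sSup ((fun s => |u (t - s) x - u t x|) '' Icc 0 ε)) (𝓝[>] 0) (𝓝 0)

lemma Dk_le (k : ℝ → ℝ) (T : ℝ) (hk : KernelOK k T) (v : ℝ → ℝ)
    (hv : ContinuousOn v (Icc 0 T)) (c : ℝ) (hc : 0 ≤ c) (t : ℝ) (ht : t ∈ Ioc 0 T)
    (s : ℝ) (hs : 0 ≤ s) (hst : s < t) (m : ℝ) (hm : m ≤ 0) (hvt : v t = m)
    (hmin : ∀ τ ∈ Icc 0 t, m ≤ v τ) (hpos : ∀ τ ∈ Icc 0 s, 0 ≤ v τ)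
    (hd : DifferentiableWithinAt ℝ (kConv k (fun τ => v τ - c)) (Icc 0 T) t)
    (h4 : Tendsto (fun ε => ε⁻¹ * (∫ τ in (0:ℝ)..ε, k τ) *
        sSup ((fun s => |v (t - s) - v t|) '' Icc 0 ε)) (𝓝[>] 0) (𝓝 0)) :
    Dk k T (fun τ => v τ - c) t ≤ m * k (t - s) := by
  obtain ⟨hki, hkc, hkp, hkd⟩ := hk
  have ht0 := ht.1
  have htT := ht.2
  have hder := hd.hasDerivWithinAt
  have hlim : Tendsto (fun ε => ε⁻¹ * (kConv k (fun τ => v τ - c) t -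
      kConv k (fun τ => v τ - c) (t - ε))) (𝓝[>] 0) (𝓝 (Dk k T (fun τ => v τ - c) t)) := by
    have h1 := hasDerivWithinAt_iff_tendsto_slope.1 hder
    have h2 : Tendsto (fun ε : ℝ => t - ε) (𝓝[>] 0) (𝓝[Icc 0 T \ {t}] t) := by
      refine tendsto_nhdsWithin_iff.2 ⟨?_, ?_⟩
      · have : Tendsto (fun ε : ℝ => t - ε) (𝓝 0) (𝓝 (t - 0)) :=
          (continuous_const.sub continuous_id).tendsto 0
        rw [sub_zero] at this
        exact this.mono_left nhdsWithin_le_nhds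
      · filter_upwards [Ioo_mem_nhdsGT ht0] with ε hε
        refine ⟨⟨by linarith [hε.2], by linarith [hε.1]⟩, ?_⟩
        simp only [mem_singleton_iff]
        linarith [hε.1]
    refine (h1.comp h2).congr fun ε => ?_
    simp only [Function.comp, slope, vsub_eq_sub, smul_eq_mul]
    rw [show t - ε - t = -ε by ring, inv_neg]
    ring
  have hev : ∀ᶠ ε in 𝓝[>] (0:ℝ), ε⁻¹ * (kConv k (fun τ => v τ - c) t -
      kConv k (fun τ => v τ - c) (t - ε)) ≤ m * k (t - s) + ε⁻¹ * (∫ τ in (0:ℝ)..ε, k τ) *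
        sSup ((fun s => |v (t - s) - v t|) '' Icc 0 ε) := by
    filter_upwards [Ioo_mem_nhdsGT (sub_pos.2 hst)] with ε hε
    obtain ⟨hε0, hε1⟩ := hε
    set S := sSup ((fun s => |v (t - s) - v t|) '' Icc 0 ε) with hS
    have hSb : ∀ τ ∈ Icc (t - ε) t, v τ ≤ m + S := by
      intro τ hτ
      have hb : BddAbove ((fun s => |v (t - s) - v t|) '' Icc 0 ε) := by
        refine (isCompact_Icc.image_of_continuousOn ?_).bddAbove
        refine ContinuousOn.abs (ContinuousOn.sub ?_ continuousOn_const)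
        refine hv.comp (by fun_prop) ?_
        intro r hr
        exact ⟨by linarith [hr.2], by linarith [hr.1]⟩
      have := le_csSup hb (mem_image_of_mem _ (show t - τ ∈ Icc 0 ε from
        ⟨by linarith [hτ.2], by linarith [hτ.1]⟩))
      simp only [sub_sub_cancel] at this
      rw [← hS, hvt] at this
      linarith [le_abs_self (v τ - m)]
    have kint : ∀ a ∈ Icc 0 T, ∀ b ∈ Icc 0 T, IntervalIntegrable k volume a b := by
      intro a ha b hb
      rw [intervalIntegrable_iff]
      refine hki.mono_set ?_
      intro r hr
      rw [mem_uIoc] at hr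
      rcases hr with hr | hr
      · exact ⟨by linarith [ha.1], by linarith [hb.2]⟩
      · exact ⟨by linarith [hb.1], by linarith [ha.2]⟩
    have kint' : ∀ p, ∀ a, ∀ b, p - a ∈ Icc 0 T → p - b ∈ Icc 0 T →
        IntervalIntegrable (fun τ => k (p - τ)) volume a b := by
      intro p a b ha hb
      have := (kint _ ha _ hb).comp_sub_left p
      simpa using this
    have kwint : ∀ p, ∀ a ∈ Icc 0 T, ∀ b ∈ Icc 0 T, p - a ∈ Icc 0 T → p - b ∈ Icc 0 T →
        IntervalIntegrable (fun τ => k (p - τ) * (v τ - c)) volume a b := by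
      intro p a ha b hb h1 h2
      refine (kint' p a b h1 h2).mul_continuousOn ?_
      refine (hv.mono ?_).sub continuousOn_const
      exact ordConnected_Icc.uIcc_subset ha hb
    set G : ℝ → ℝ := fun x => ∫ τ in (0:ℝ)..x, k τ with hG
    have hGI : ∀ p, ∀ a, ∀ b, p - a ∈ Icc 0 T → p - b ∈ Icc 0 T →
        ∫ τ in a..b, k (p - τ) = G (p - a) - G (p - b) := by
      intro p a b ha hb
      rw [intervalIntegral.integral_comp_sub_left]
      have h0 : (0:ℝ) ∈ Icc 0 T := ⟨le_rfl, by linarith⟩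
      exact (intervalIntegral.integral_interval_sub_left (kint _ h0 _ ha) (kint _ h0 _ hb)).symm
    have hmono1 : ∀ τ ∈ Ioo 0 (t - ε), k (t - τ) - k (t - ε - τ) ≤ 0 := by
      intro τ hτ
      have := hkd (t - ε - τ) ⟨by linarith [hτ.2], by linarith [hτ.1]⟩ (t - τ)
        ⟨by linarith [hτ.2], by linarith [hτ.1]⟩ (by linarith)
      linarith
    have I1 : ∫ τ in (0:ℝ)..s, (k (t - τ) - k (t - ε - τ)) * (v τ - c) ≤
        ∫ τ in (0:ℝ)..s, (k (t - τ) - k (t - ε - τ)) * (-c) := by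
      refine intervalIntegral.integral_mono_on_of_le_Ioo hs ?_ ?_ ?_
      · simp only [sub_mul]
        refine (kwint _ _ ⟨?_, ?_⟩ _ ⟨?_, ?_⟩ ⟨?_, ?_⟩ ⟨?_, ?_⟩).sub
          (kwint _ _ ⟨?_, ?_⟩ _ ⟨?_, ?_⟩ ⟨?_, ?_⟩ ⟨?_, ?_⟩) <;> linarith
      · refine ((kint' _ _ _ ⟨?_, ?_⟩ ⟨?_, ?_⟩).sub (kint' _ _ _ ⟨?_, ?_⟩ ⟨?_, ?_⟩)).mul_const _ <;>
          linarith
      · intro τ hτ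
        refine mul_le_mul_of_nonpos_left ?_ (hmono1 τ ⟨hτ.1, by linarith [hτ.2]⟩)
        linarith [hpos τ ⟨hτ.1.le, hτ.2.le⟩]
    have I2 : ∫ τ in s..(t - ε), (k (t - τ) - k (t - ε - τ)) * (v τ - c) ≤
        ∫ τ in s..(t - ε), (k (t - τ) - k (t - ε - τ)) * (m - c) := by
      refine intervalIntegral.integral_mono_on_of_le_Ioo (by linarith) ?_ ?_ ?_
      · simp only [sub_mul]
        refine (kwint _ _ ⟨?_, ?_⟩ _ ⟨?_, ?_⟩ ⟨?_, ?_⟩ ⟨?_, ?_⟩).sub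
          (kwint _ _ ⟨?_, ?_⟩ _ ⟨?_, ?_⟩ ⟨?_, ?_⟩ ⟨?_, ?_⟩) <;> linarith
      · refine ((kint' _ _ _ ⟨?_, ?_⟩ ⟨?_, ?_⟩).sub (kint' _ _ _ ⟨?_, ?_⟩ ⟨?_, ?_⟩)).mul_const _ <;>
          linarith
      · intro τ hτ
        refine mul_le_mul_of_nonpos_left ?_ (hmono1 τ ⟨by linarith [hτ.1], by linarith [hτ.2]⟩)
        linarith [hmin τ ⟨by linarith [hτ.1], by linarith [hτ.2]⟩]
    have I3 : ∫ τ in (t - ε)..t, k (t - τ) * (v τ - c) ≤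
        ∫ τ in (t - ε)..t, k (t - τ) * (m + S - c) := by
      refine intervalIntegral.integral_mono_on_of_le_Ioo (by linarith) ?_ ?_ ?_
      · refine kwint _ _ ⟨?_, ?_⟩ _ ⟨?_, ?_⟩ ⟨?_, ?_⟩ ⟨?_, ?_⟩ <;> linarith
      · refine (kint' _ _ _ ⟨?_, ?_⟩ ⟨?_, ?_⟩).mul_const _ <;> linarith
      · intro τ hτ
        refine mul_le_mul_of_nonneg_left ?_
          (hkp (t - τ) ⟨by linarith [hτ.2], by linarith [hτ.1]⟩).le
        linarith [hSb τ ⟨hτ.1.le, hτ.2.le⟩]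
    rw [intervalIntegral.integral_mul_const, intervalIntegral.integral_sub
      (by refine kint' _ _ _ ⟨?_, ?_⟩ ⟨?_, ?_⟩ <;> linarith)
      (by refine kint' _ _ _ ⟨?_, ?_⟩ ⟨?_, ?_⟩ <;> linarith),
      hGI _ _ _ (by constructor <;> linarith) (by constructor <;> linarith),
      hGI _ _ _ (by constructor <;> linarith) (by constructor <;> linarith)] at I1 I2
    rw [intervalIntegral.integral_mul_const,
      hGI _ _ _ (by constructor <;> linarith) (by constructor <;> linarith)] at I3
    have hG0 : G 0 = 0 := by simp [hG]
    have split : kConv k (fun τ => v τ - c) t - kConv k (fun τ => v τ - c) (t - ε) =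
        (∫ τ in (0:ℝ)..s, (k (t - τ) - k (t - ε - τ)) * (v τ - c)) +
        (∫ τ in s..(t - ε), (k (t - τ) - k (t - ε - τ)) * (v τ - c)) +
        ∫ τ in (t - ε)..t, k (t - τ) * (v τ - c) := by
      unfold kConv
      rw [intervalIntegral.integral_add_adjacent_intervals]
      · simp only [sub_mul (k _)]
        rw [intervalIntegral.integral_sub, sub_add_eq_add_sub,
          intervalIntegral.integral_add_adjacent_intervals]
        all_goals refine kwint _ _ ⟨?_, ?_⟩ _ ⟨?_, ?_⟩ ⟨?_, ?_⟩ ⟨?_, ?_⟩ <;> linarith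
      all_goals
        simp only [sub_mul (k _)]
        refine (kwint _ _ ⟨?_, ?_⟩ _ ⟨?_, ?_⟩ ⟨?_, ?_⟩ ⟨?_, ?_⟩).sub
          (kwint _ _ ⟨?_, ?_⟩ _ ⟨?_, ?_⟩ ⟨?_, ?_⟩ ⟨?_, ?_⟩) <;> linarith
    have hmonoG : ∀ b ∈ Ioc 0 T, ε ≤ b → ε * k b ≤ G b - G (b - ε) := by
      intro b hb hεb
      have h0 : (0:ℝ) ∈ Icc 0 T := ⟨le_rfl, by linarith⟩
      have hbm : b ∈ Icc 0 T := ⟨hb.1.le, hb.2⟩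
      have hbm' : b - ε ∈ Icc 0 T := ⟨by linarith, by linarith [hb.2]⟩
      have e : G b - G (b - ε) = ∫ τ in (b - ε)..b, k τ :=
        intervalIntegral.integral_interval_sub_left (kint _ h0 _ hbm) (kint _ h0 _ hbm')
      rw [e]
      have : ∫ τ in (b - ε)..b, k b ≤ ∫ τ in (b - ε)..b, k τ := by
        refine intervalIntegral.integral_mono_on_of_le_Ioo (by linarith) (by simp)
          (kint _ hbm' _ hbm) ?_
        intro τ hτ
        exact hkd τ ⟨by linarith [hτ.1], by linarith [hτ.2, hb.2]⟩ b hb hτ.2.le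
      simpa using this
    have g1 := hmonoG t ht (by linarith)
    have g2 := hmonoG (t - s) ⟨by linarith, by linarith⟩ hε1.le
    have g3 : 0 ≤ ε * k t := (mul_pos hε0 (hkp t ht)).le
    have key : kConv k (fun τ => v τ - c) t - kConv k (fun τ => v τ - c) (t - ε) ≤
        ε * (m * k (t - s)) + G ε * S := by
      rw [split]
      have r1 : t - ε - s = t - s - ε := by ring
      simp only [sub_zero, sub_self, sub_sub_cancel, hG0, r1] at I1 I2 I3
      have q1 : 0 ≤ c * (G t - G (t - ε)) := mul_nonneg hc (by linarith)
      have q2 := mul_le_mul_of_nonpos_left g2 hm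
      linarith
    calc _ ≤ ε⁻¹ * (ε * (m * k (t - s)) + G ε * S) :=
          mul_le_mul_of_nonneg_left key (inv_pos.2 hε0).le
      _ = _ := by
          rw [mul_add, inv_mul_cancel_left₀ hε0.ne', mul_assoc]
  have hlim2 := (tendsto_const_nhds (x := m * k (t - s))).add h4
  rw [add_zero] at hlim2
  exact le_of_tendsto_of_tendsto hlim hlim2 hev

open scoped MatrixOrder ComplexOrder in
lemma psd_factor {n : ℕ} {H : Matrix (Fin n) (Fin n) ℝ} (hP : H.PosSemidef) :
    ∃ B : Matrix (Fin n) (Fin n) ℝ, H = star B * B :=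
  CStarAlgebra.nonneg_iff_eq_star_mul_self.mp hP.nonneg

lemma second_deriv_nonneg (φ φ' : ℝ → ℝ) (d : ℝ) (hφ : ∀ᶠ r in 𝓝 (0:ℝ), HasDerivAt φ (φ' r) r)
    (hφ' : HasDerivAt φ' d 0) (hmin : IsLocalMin φ 0) : 0 ≤ d := by
  by_contra hd
  push Not at hd
  have e1 : deriv φ =ᶠ[𝓝 0] φ' := hφ.mono fun r hr => hr.deriv
  have e0 : deriv φ 0 = 0 := hmin.deriv_eq_zero
  have e2 : deriv (deriv φ) 0 = d := by rw [e1.deriv_eq, hφ'.deriv]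
  have hmax : IsLocalMax φ 0 :=
    isLocalMax_of_deriv_deriv_neg (by rw [e2]; exact hd) e0 hφ.self_of_nhds.continuousAt
  have hc : φ =ᶠ[𝓝 0] fun _ => φ 0 := by
    filter_upwards [hmin, hmax] with r h1 h2
    exact le_antisymm h2 h1
  have h1 : deriv φ =ᶠ[𝓝 0] fun _ => 0 := by
    have := hc.deriv
    refine this.trans ?_
    simp [Filter.EventuallyEq.refl]
  have h2 := h1.deriv_eq
  rw [e2] at h2
  simp at h2
  linarith

lemma fderiv_eq_sum_pd {n : ℕ} (v : (Fin n → ℝ) → ℝ) (x ξ : Fin n → ℝ) :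
    fderiv ℝ v x ξ = ∑ j, ξ j * pd j v x := by
  conv_lhs => rw [pi_eq_sum_univ' ξ]
  simp [pd, map_sum]

lemma hess_nonneg {n : ℕ} (v : (Fin n → ℝ) → ℝ) (Ω : Set (Fin n → ℝ)) (hΩ : IsOpen Ω)
    (hd : ∀ x ∈ Ω, DifferentiableAt ℝ v x ∧ ∀ j, DifferentiableAt ℝ (pd j v) x)
    (x : Fin n → ℝ) (hx : x ∈ Ω) (hmin : IsLocalMin v x) (ξ : Fin n → ℝ) :
    0 ≤ ∑ i, ∑ j, ξ i * ξ j * pd i (pd j v) x := by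
  have hl : ∀ r : ℝ, HasDerivAt (fun r : ℝ => x + r • ξ) ξ r := fun r => by
    simpa using ((hasDerivAt_id r).smul_const ξ).const_add x
  have hcont : Continuous (fun r : ℝ => x + r • ξ) := by fun_prop
  have hx0 : x + (0:ℝ) • ξ = x := by simp
  refine second_deriv_nonneg (fun r => v (x + r • ξ))
    (fun r => ∑ j, ξ j * pd j v (x + r • ξ)) _ ?_ ?_ ?_
  · have : ∀ᶠ r in 𝓝 (0:ℝ), x + r • ξ ∈ Ω := by
      refine hcont.continuousAt.eventually_mem ?_
      rw [hx0]; exact hΩ.mem_nhds hx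
    filter_upwards [this] with r hr
    have := (hd _ hr).1.hasFDerivAt.comp_hasDerivAt r (hl r)
    rw [fderiv_eq_sum_pd] at this
    exact this
  · have : ∀ j, HasDerivAt (fun r : ℝ => ξ j * pd j v (x + r • ξ))
        (ξ j * ∑ i, ξ i * pd i (pd j v) x) 0 := by
      intro j
      refine HasDerivAt.const_mul _ ?_
      have h := ((hd _ hx).2 j).hasFDerivAt
      rw [← hx0] at h
      have := h.comp_hasDerivAt 0 (hl 0)
      rw [hx0, fderiv_eq_sum_pd] at this
      exact this
    have h := HasDerivAt.fun_sum (u := Finset.univ) fun j _ => this j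
    have e : ∑ j, ξ j * ∑ i, ξ i * pd i (pd j v) x =
        ∑ i, ∑ j, ξ i * ξ j * pd i (pd j v) x := by
      rw [Finset.sum_comm]
      refine Finset.sum_congr rfl fun j _ => ?_
      rw [Finset.mul_sum]
      refine Finset.sum_congr rfl fun i _ => ?_
      ring
    rw [e] at h
    exact h
  · have h : IsLocalMin v (x + (0:ℝ) • ξ) := by rw [hx0]; exact hmin
    exact h.comp_continuous (g := fun r : ℝ => x + r • ξ) hcont.continuousAt

lemma hess_symm {n : ℕ} (v : (Fin n → ℝ) → ℝ) (Ω : Set (Fin n → ℝ)) (hΩ : IsOpen Ω)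
    (hd : ∀ x ∈ Ω, DifferentiableAt ℝ v x ∧ ∀ j, DifferentiableAt ℝ (pd j v) x)
    (x : Fin n → ℝ) (hx : x ∈ Ω) (i j : Fin n) : pd i (pd j v) x = pd j (pd i v) x := by
  have hD : DifferentiableAt ℝ (fderiv ℝ v) x := by
    have : fderiv ℝ v = fun y => ∑ j, pd j v y • (ContinuousLinearMap.proj j : (Fin n → ℝ) →L[ℝ] ℝ) := by
      funext y
      ext1 ξ
      rw [fderiv_eq_sum_pd]
      simp [mul_comm]
    rw [this]
    refine DifferentiableAt.fun_sum fun j _ => ?_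
    exact ((hd x hx).2 j).smul_const _
  have h := second_derivative_symmetric_of_eventually (f := v) (f' := fderiv ℝ v)
    (f'' := fderiv ℝ (fderiv ℝ v) x) (x := x)
    (by filter_upwards [hΩ.mem_nhds hx] with y hy using (hd y hy).1.hasFDerivAt)
    hD.hasFDerivAt (Pi.single i 1) (Pi.single j 1)
  have e : ∀ i j : Fin n, pd i (pd j v) x =
      fderiv ℝ (fderiv ℝ v) x (Pi.single i 1) (Pi.single j 1) := by
    intro i j
    unfold pd
    rw [fderiv_clm_apply hD (by fun_prop)]
    simp
  rw [e, e, h]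

lemma ellOp_nonneg {n : ℕ} (aC : Fin n → Fin n → (Fin n → ℝ) → ℝ)
    (bC : Fin n → (Fin n → ℝ) → ℝ) (v : (Fin n → ℝ) → ℝ) (Ω : Set (Fin n → ℝ)) (hΩ : IsOpen Ω)
    (hell : IsElliptic aC Ω)
    (hd : ∀ x ∈ Ω, DifferentiableAt ℝ v x ∧ ∀ j, DifferentiableAt ℝ (pd j v) x)
    (x : Fin n → ℝ) (hx : x ∈ Ω) (hmin : IsLocalMin v x) : 0 ≤ ellOp aC bC v x := by
  have h1 : ∀ j, pd j v x = 0 := fun j => by simp [pd, hmin.fderiv_eq_zero]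
  unfold ellOp
  simp only [h1, mul_zero, Finset.sum_const_zero, add_zero]
  set H : Matrix (Fin n) (Fin n) ℝ := Matrix.of fun i j => pd i (pd j v) x with hH
  have hP : H.PosSemidef := by
    refine Matrix.PosSemidef.of_dotProduct_mulVec_nonneg ?_ ?_
    · ext i j
      simp [hH, hess_symm v Ω hΩ hd x hx i j]
    · intro ξ
      have := hess_nonneg v Ω hΩ hd x hx hmin ξ
      refine this.trans_eq ?_
      simp only [dotProduct, Matrix.mulVec, hH, Matrix.of_apply, Finset.mul_sum, star_trivial]
      refine Finset.sum_congr rfl fun i _ => Finset.sum_congr rfl fun j _ => ?_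
      ring
  obtain ⟨B, hB⟩ := psd_factor hP
  obtain ⟨c, hc, hE⟩ := hell
  have hij : ∀ i j, pd i (pd j v) x = ∑ l, B l i * B l j := by
    intro i j
    have := congrFun (congrFun hB i) j
    simpa [hH, Matrix.mul_apply] using this
  have : ∑ i, ∑ j, aC i j x * pd i (pd j v) x =
      ∑ l, ∑ i, ∑ j, aC i j x * B l i * B l j := by
    simp only [hij, Finset.mul_sum]
    symm
    rw [Finset.sum_comm]
    refine Finset.sum_congr rfl fun i _ => ?_
    rw [Finset.sum_comm]
    refine Finset.sum_congr rfl fun j _ => Finset.sum_congr rfl fun l _ => ?_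
    ring
  rw [this]
  refine Finset.sum_nonneg fun l _ => le_trans ?_ (hE x hx (B l))
  exact mul_nonneg hc.le (Finset.sum_nonneg fun i _ => sq_nonneg _)

/-- **Corollary 1, Dirichlet case.**  Under the assumptions of the positivity principle,
if `f(0,t₀,x₀) > 0` for some `(t₀,x₀) ∈ (0,T] × Ω`, then `u(t₀,x₀) > 0`. -/
theorem strict_positivity {n : ℕ}
    (T : ℝ) (hT : 0 < T)
    (Ω : Set (Fin n → ℝ)) (hΩo : IsOpen Ω) (hΩb : Bornology.IsBounded Ω)
    (aC : Fin n → Fin n → (Fin n → ℝ) → ℝ) (bC : Fin n → (Fin n → ℝ) → ℝ)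
    (haC : ∀ i j, ContinuousOn (aC i j) (closure Ω))
    (hbC : ∀ j, ContinuousOn (bC j) (closure Ω))
    (hell : IsElliptic aC Ω)
    (k : ℝ → ℝ) (hk : KernelOK k T)
    (hkinf : Tendsto k (𝓝[>] 0) atTop)
    (f : ℝ → ℝ → (Fin n → ℝ) → ℝ)
    (hf : ContinuousOn (fun p : ℝ × ℝ × (Fin n → ℝ) => f p.1 p.2.1 p.2.2)
      ((univ : Set ℝ) ×ˢ (Icc 0 T ×ˢ closure Ω)))
    (hflow : ∃ M ≥ (0:ℝ), ∃ η > (0:ℝ), ∀ w ∈ Ioo (-η) (0:ℝ), ∀ t ∈ Icc (0:ℝ) T,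
      ∀ x ∈ closure Ω, -M * |w| ≤ f w t x)
    (u : ℝ → (Fin n → ℝ) → ℝ) (u₀ : (Fin n → ℝ) → ℝ) (g : ℝ → (Fin n → ℝ) → ℝ)
    (hu : ContinuousOn (fun p : ℝ × (Fin n → ℝ) => u p.1 p.2) (Icc 0 T ×ˢ closure Ω))
    (hux : ∀ j, ContinuousOn (fun p : ℝ × (Fin n → ℝ) => pd j (u p.1) p.2)
      (Ioc 0 T ×ˢ closure Ω))
    (huxx : ∀ i j, ContinuousOn (fun p : ℝ × (Fin n → ℝ) => pd i (pd j (u p.1)) p.2)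
      (Ioc 0 T ×ˢ closure Ω))
    (hudiff : ∀ t ∈ Ioc (0:ℝ) T, ∀ x ∈ Ω,
      DifferentiableAt ℝ (u t) x ∧ ∀ j, DifferentiableAt ℝ (pd j (u t)) x)
    (hDkdiff : ∀ x ∈ closure Ω, ∀ t ∈ Ioc (0:ℝ) T,
      DifferentiableWithinAt ℝ (kConv k (fun τ => u τ x - u₀ x)) (Icc 0 T) t)
    (hDkcont : ContinuousOn
      (fun p : ℝ × (Fin n → ℝ) => Dk k T (fun τ => u τ p.2 - u₀ p.2) p.1)
      (Ioc 0 T ×ˢ closure Ω))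
    (heq : ∀ t ∈ Ioo (0:ℝ) T, ∀ x ∈ Ω,
      Dk k T (fun τ => u τ x - u₀ x) t = ellOp aC bC (u t) x + f (u t x) t x)
    (hinit : ∀ x ∈ closure Ω, u 0 x = u₀ x)
    (hbc : ∀ t ∈ Ioo (0:ℝ) T, ∀ x ∈ frontier Ω, u t x = g t x)
    (has4 : As4 k T Ω u)
    (hu₀ : ∀ x ∈ Ω, 0 ≤ u₀ x)
    (hg : ∀ t ∈ Ioo (0:ℝ) T, ∀ x ∈ frontier Ω, 0 ≤ g t x)
    (t₀ : ℝ) (x₀ : Fin n → ℝ) (ht₀ : t₀ ∈ Ioc (0:ℝ) T) (hx₀ : x₀ ∈ Ω)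
    (hfpos : 0 < f 0 t₀ x₀) :
    0 < u t₀ x₀ := by
  obtain ⟨M, hM, η, hη, hfl⟩ := hflow
  have hcomp : IsCompact (closure Ω) := hΩb.isCompact_closure
  have hk' := hk
  obtain ⟨hki, hkc, hkp, hkd⟩ := hk'
  have hcl : Ioc (0:ℝ) T ⊆ closure (Ioo 0 T) := by
    rw [closure_Ioo hT.ne]; exact Ioc_subset_Icc_self
  have hut : ∀ x ∈ closure Ω, ContinuousOn (fun t => u t x) (Icc 0 T) := by
    intro x hx
    exact hu.comp (f := fun t : ℝ => (t, x)) (by fun_prop) fun t ht => ⟨ht, hx⟩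
  have hsec : ∀ x ∈ closure Ω, MapsTo (fun t : ℝ => (t, x)) (Ioc 0 T) (Ioc 0 T ×ˢ closure Ω) :=
    fun x hx t ht => ⟨ht, hx⟩
  have heq' : ∀ x ∈ Ω, ∀ t ∈ Ioc (0:ℝ) T,
      Dk k T (fun τ => u τ x - u₀ x) t = ellOp aC bC (u t) x + f (u t x) t x := by
    intro x hx
    have hxc := subset_closure hx
    have hE : EqOn (fun t => Dk k T (fun τ => u τ x - u₀ x) t)
        (fun t => ellOp aC bC (u t) x + f (u t x) t x) (Ioo 0 T) := fun t ht => heq t ht x hx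
    refine hE.of_subset_closure ?_ ?_ Ioo_subset_Ioc_self hcl
    · exact hDkcont.comp (f := fun t : ℝ => (t, x)) (by fun_prop) (hsec x hxc)
    · refine ContinuousOn.add ?_ ?_
      · unfold ellOp
        refine ContinuousOn.add ?_ ?_
        · refine continuousOn_finsetSum _ fun i _ => continuousOn_finsetSum _ fun j _ => ?_
          refine continuousOn_const.mul ?_
          exact (huxx i j).comp (f := fun t : ℝ => (t, x)) (by fun_prop) (hsec x hxc)
        · refine continuousOn_finsetSum _ fun j _ => ?_
          refine continuousOn_const.mul ?_
          exact (hux j).comp (f := fun t : ℝ => (t, x)) (by fun_prop) (hsec x hxc)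
      · refine hf.comp (f := fun t : ℝ => (u t x, t, x)) ?_ ?_
        · exact ((hut x hxc).mono Ioc_subset_Icc_self).prodMk (by fun_prop)
        · intro t ht
          exact ⟨mem_univ _, Ioc_subset_Icc_self ht, hxc⟩
  have hbd : ∀ x ∈ frontier Ω, ∀ t ∈ Ioc (0:ℝ) T, 0 ≤ u t x := by
    intro x hx t ht
    have hxc := frontier_subset_closure hx
    have hc : ContinuousWithinAt (fun t => u t x) (Ioo 0 T) t :=
      ((hut x hxc) t (Ioc_subset_Icc_self ht)).mono Ioo_subset_Icc_self
    have : t ∈ closure (Ioo 0 T) := hcl ht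
    haveI := mem_closure_iff_nhdsWithin_neBot.1 this
    refine ge_of_tendsto hc ?_
    filter_upwards [self_mem_nhdsWithin] with r hr
    rw [hbc r hr x hx]; exact hg r hr x hx
  have hin : ∀ x ∈ closure Ω, 0 ≤ u 0 x := by
    intro x hx
    have hc : ContinuousOn (fun y => u 0 y) (closure Ω) :=
      hu.comp (f := fun y : Fin n → ℝ => ((0:ℝ), y)) (by fun_prop) fun y hy =>
        ⟨⟨le_rfl, hT.le⟩, hy⟩
    have hc' : ContinuousWithinAt (fun y => u 0 y) Ω x := (hc x hx).mono subset_closure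
    haveI := mem_closure_iff_nhdsWithin_neBot.1 hx
    refine ge_of_tendsto hc' ?_
    filter_upwards [self_mem_nhdsWithin] with y hy
    rw [hinit y (subset_closure hy)]; exact hu₀ y hy
  have hcmp : ∀ t ∈ Ioc (0:ℝ) T, ∀ x ∈ Ω, ∀ s, 0 ≤ s → s < t → u t x ≤ 0 →
      (∀ τ ∈ Icc 0 t, ∀ y ∈ closure Ω, u t x ≤ u τ y) →
      (∀ τ ∈ Icc 0 s, 0 ≤ u τ x) → f (u t x) t x ≤ u t x * k (t - s) := by
    intro t ht x hx s hs hst hm hmin hpos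
    have hxc := subset_closure hx
    have h1 := Dk_le k T hk (fun τ => u τ x) (hut x hxc) (u₀ x) (hu₀ x hx) t ht s hs hst (u t x)
      hm rfl (fun τ hτ => hmin τ hτ x hxc) hpos (hDkdiff x hxc t ht) (has4 t ht x hxc)
    have h2 : 0 ≤ ellOp aC bC (u t) x := by
      refine ellOp_nonneg aC bC (u t) Ω hΩo hell (hudiff t ht) x hx ?_
      filter_upwards [hΩo.mem_nhds hx] with y hy
      exact hmin t ⟨ht.1.le, le_rfl⟩ y (subset_closure hy)
    rw [heq' x hx t ht] at h1
    linarith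
  have hnonneg : ∀ t ∈ Icc (0:ℝ) T, ∀ x ∈ closure Ω, 0 ≤ u t x := by
    by_contra hcon
    push Not at hcon
    obtain ⟨t₁, ht₁, x₁, hx₁, hneg₁⟩ := hcon
    set S : Set ℝ := {t | t ∈ Icc (0:ℝ) T ∧ ∃ x ∈ closure Ω, u t x < 0} with hS
    have hSne : S.Nonempty := ⟨t₁, ht₁, x₁, hx₁, hneg₁⟩
    have hSb : BddBelow S := ⟨0, fun t ht => ht.1.1⟩
    set s := sInf S with hs
    have hs0 : 0 ≤ s := le_csInf hSne fun t ht => ht.1.1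
    have hsT : s ≤ T := (csInf_le hSb hSne.some_mem).trans hSne.some_mem.1.2
    have hlt : ∀ τ ∈ Ico 0 s, ∀ x ∈ closure Ω, 0 ≤ u τ x := by
      intro τ hτ x hx
      by_contra hh
      push Not at hh
      exact absurd (csInf_le hSb ⟨⟨hτ.1, hτ.2.le.trans hsT⟩, x, hx, hh⟩) (not_le.2 hτ.2)
    have hle : ∀ τ ∈ Icc 0 s, ∀ x ∈ closure Ω, 0 ≤ u τ x := by
      intro τ hτ x hx
      rcases hτ.2.lt_or_eq with h | h
      · exact hlt τ ⟨hτ.1, h⟩ x hx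
      rcases hs0.eq_or_lt with h0 | h0
      · rw [h, ← h0]; exact hin x hx
      rw [h]
      have hc : ContinuousWithinAt (fun t => u t x) (Ico 0 s) s :=
        ((hut x hx) s ⟨hs0, hsT⟩).mono fun r hr => ⟨hr.1, hr.2.le.trans hsT⟩
      have : s ∈ closure (Ico 0 s) := by
        rw [closure_Ico h0.ne]; exact ⟨hs0, le_rfl⟩
      haveI := mem_closure_iff_nhdsWithin_neBot.1 this
      refine ge_of_tendsto hc ?_
      filter_upwards [self_mem_nhdsWithin] with r hr
      exact hlt r hr x hx
    have huc := (isCompact_Icc.prod hcomp).uniformContinuousOn_of_continuous hu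
    rw [Metric.uniformContinuousOn_iff] at huc
    obtain ⟨δ, hδ, hucδ⟩ := huc η hη
    have hkM : ∃ δ₂ > 0, ∀ r ∈ Ioo (0:ℝ) δ₂, M < k r := by
      have := hkinf.eventually_gt_atTop M
      obtain ⟨δ₂, h2, h3⟩ := (mem_nhdsGT_iff_exists_Ioo_subset).1 this
      exact ⟨δ₂, h2, h3⟩
    obtain ⟨δ₂, hδ₂, hkδ⟩ := hkM
    obtain ⟨t', ht', htlt⟩ := exists_lt_of_csInf_lt hSne
      (show s < s + min δ δ₂ by linarith [lt_min hδ hδ₂])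
    obtain ⟨ht'I, x', hx', hneg'⟩ := ht'
    have hsub : Icc 0 t' ×ˢ closure Ω ⊆ Icc 0 T ×ˢ closure Ω :=
      prod_mono (Icc_subset_Icc_right ht'I.2) Subset.rfl
    obtain ⟨⟨t, x⟩, ⟨htm, hxm⟩, hmin⟩ := (isCompact_Icc.prod hcomp).exists_isMinOn
      (s := Icc 0 t' ×ˢ closure Ω) ⟨(t', x'), ⟨⟨ht'I.1, le_rfl⟩, hx'⟩⟩ (hu.mono hsub)
    simp only at htm hxm
    have hmin' : ∀ τ ∈ Icc 0 t', ∀ y ∈ closure Ω, u t x ≤ u τ y := fun τ hτ y hy =>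
      hmin (show (τ, y) ∈ Icc 0 t' ×ˢ closure Ω from ⟨hτ, hy⟩)
    have hneg : u t x < 0 := (hmin' t' ⟨ht'I.1, le_rfl⟩ x' hx').trans_lt hneg'
    have hst : s < t := by
      by_contra hh
      push Not at hh
      linarith [hle t ⟨htm.1, hh⟩ x hxm]
    have htI : t ∈ Ioc (0:ℝ) T := ⟨by linarith, htm.2.trans ht'I.2⟩
    have hxΩ : x ∈ Ω := by
      by_contra hh
      have : x ∈ frontier Ω := ⟨hxm, by rwa [hΩo.interior_eq]⟩
      linarith [hbd x this t htI]
    have hts : t - s < min δ δ₂ := by linarith [htm.2]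
    have hts1 := hts.trans_le (min_le_left _ _)
    have hts2 := hts.trans_le (min_le_right _ _)
    have hη' : -η < u t x := by
      have h := hucδ (t, x) ⟨Ioc_subset_Icc_self htI, hxm⟩ (s, x) ⟨⟨hs0, hsT⟩, hxm⟩ (by
        rw [dist_prod_same_right, Real.dist_eq, abs_of_pos (by linarith)]; exact hts1)
      rw [Real.dist_eq] at h
      have := (abs_lt.1 h).1
      simp only at this
      linarith [hle s ⟨hs0, le_rfl⟩ x hxm]
    have h1 := hcmp t htI x hxΩ s hs0 hst hneg.le
      (fun τ hτ y hy => hmin' τ ⟨hτ.1, hτ.2.trans htm.2⟩ y hy) (fun τ hτ => hle τ hτ x hxm)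
    have h2 := hfl (u t x) ⟨hη', hneg⟩ t (Ioc_subset_Icc_self htI) x hxm
    rw [abs_of_neg hneg] at h2
    have h3 := hkδ (t - s) ⟨by linarith, hts2⟩
    nlinarith
  have hx₀c := subset_closure hx₀
  refine lt_of_le_of_ne (hnonneg t₀ (Ioc_subset_Icc_self ht₀) x₀ hx₀c) fun h0 => ?_
  have h1 := hcmp t₀ ht₀ x₀ hx₀ 0 le_rfl ht₀.1 h0.symm.le
    (fun τ hτ y hy => by
      rw [← h0]; exact hnonneg τ ⟨hτ.1, hτ.2.trans ht₀.2⟩ y hy)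
    (fun τ hτ => hnonneg τ ⟨hτ.1, hτ.2.trans hT.le⟩ x₀ hx₀c)
  rw [← h0, zero_mul] at h1
  linarith
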